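/- Let p be a depth-zero pattern of dimensions a×c whose distinct bifixes are exactly o_1, …, o_M (M ≥ 1), and for each j let p''_j be the word with p = p''_j o_j, of dimensions b_j × d_j (each b_j ≥ 1). Then for all integers n ≥ 1 and m ≥ n: s_p(n, m) = s_p(n−1, m) + s_p(n, m−1) − Σ_{k ≥ 0} (−1)^k · Σ_{i_1 + ⋯ + i_M = k, i_j ≥ 0} (k)!/(i_1! ⋯ i_M!) · s_p(n − a − Σ_j i_j b_j, m − c − Σ_j i_j d_j), where the outer sum has only finitely many nonzero terms since s_p vanishes on negative first argument. -/

import Mathlib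

/-- A step of a lattice path: `u` (up) or `r` (right). -/
inductive Step : Type
  | u : Step
  | r : Step
deriving DecidableEq

/-- A word over the alphabet `{u, r}`. -/
abbrev Word := List Step

/-- The number of letters `r` in a word. -/
def countR (w : Word) : ℕ := w.count Step.r

/-- The number of letters `u` in a word. -/
def countU (w : Word) : ℕ := w.count Step.u

/-- `dval q` = (number of `r`'s in `q`) - (number of `u`'s in `q`). -/
def dval (w : Word) : ℤ := (countR w : ℤ) - (countU w : ℤ)

/-- A pattern is depth-zero if every suffix `q` of it satisfies `dval q ≥ 0`. -/
def DepthZero (p : Word) : Prop := ∀ q : Word, q <:+ p → 0 ≤ dval q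

/-- `o` is a bifix of `p`: a nonempty proper prefix of `p` that is also a (proper) suffix. -/
def IsBifix (o p : Word) : Prop := o ≠ [] ∧ o ≠ p ∧ o <+: p ∧ o <:+ p

/-- A pattern is bifix-free if it has no bifix. -/
def BifixFree (p : Word) : Prop := ∀ o : Word, ¬ IsBifix o p

/-- `w` is a ballot path to the lattice point `(n, m)`: it has exactly `n` letters `r`
and `m` letters `u`, and every prefix has at least as many `u`'s as `r`'s. -/
def IsBallot (w : Word) (n m : ℤ) : Prop :=
  (countR w : ℤ) = n ∧ (countU w : ℤ) = m ∧
    ∀ t : Word, t <+: w → countR t ≤ countU t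

/-- `w` avoids the pattern `p`: `p` does not occur in `w` as a contiguous substring. -/
def Avoids (p w : Word) : Prop := ¬ p <:+: w

/-- `s p n m` is the number of ballot paths to `(n, m)` avoiding `p`
(`0` if `n < 0`, `m < 0`, or `m < n`, since then no such path exists). -/
noncomputable def s (p : Word) (n m : ℤ) : ℕ :=
  Set.ncard {w : Word | IsBallot w n m ∧ Avoids p w}

/-- If `S n m = t n m + ∑ j, t (n - b j) (m - d j)` on the region `n ≤ m`, with `t` and `S`
vanishing for negative first argument, then `t` is the alternating multinomial sum of shifts
of `S`. -/
theorem finsum_multinomial_shift_eq {M : ℕ} (b d : Fin M → ℕ) (t S : ℤ → ℤ → ℤ)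
    (hb : ∀ j, 1 ≤ b j) (hd : ∀ j, d j ≤ b j)
    (ht : ∀ n m, n < 0 → t n m = 0) (hS : ∀ n m, n < 0 → S n m = 0)
    (h : ∀ n m, n ≤ m → S n m = t n m + ∑ j, t (n - b j) (m - d j))
    (n m : ℤ) (hnm : n ≤ m) :
    ∑ᶠ k : ℕ, (-1 : ℤ) ^ k * ∑ i ∈ Finset.Nat.antidiagonalTuple M k,
      (Nat.multinomial Finset.univ i : ℤ) *
        S (n - ∑ j, (i j : ℤ) * (b j : ℤ)) (m - ∑ j, (i j : ℤ) * (d j : ℤ)) = t n m := by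
  have hle : ∀ k, ∀ i ∈ Finset.Nat.antidiagonalTuple M k,
      (k : ℤ) ≤ ∑ j, (i j : ℤ) * (b j : ℤ) := by
    intro k i hi
    rw [Finset.Nat.mem_antidiagonalTuple] at hi
    rw [← hi]
    push_cast
    refine Finset.sum_le_sum fun j _ => ?_
    exact_mod_cast Nat.le_mul_of_pos_right _ (hb j)
  have hsupp : (Function.support fun k : ℕ =>
      (-1 : ℤ) ^ k * ∑ i ∈ Finset.Nat.antidiagonalTuple M k,
      (Nat.multinomial Finset.univ i : ℤ) *
        S (n - ∑ j, (i j : ℤ) * (b j : ℤ)) (m - ∑ j, (i j : ℤ) * (d j : ℤ))) ⊆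
      ↑(Finset.range (n.toNat + 1)) := by
    intro k hk
    by_contra hk'
    apply hk
    simp only [Finset.coe_range, Set.mem_Iio, not_lt] at hk'
    refine mul_eq_zero_of_right _ (Finset.sum_eq_zero fun i hi => ?_)
    rw [hS _ _ (by have := hle k i hi; omega), mul_zero]
  rw [finsum_eq_sum_of_support_subset _ hsupp]
  let φ : MvPolynomial (Fin M) ℤ →ₗ[ℤ] ℤ :=
    (MvPolynomial.basisMonomials (Fin M) ℤ).constr ℤ fun e =>
      t (n - ∑ j, (e j : ℤ) * (b j : ℤ)) (m - ∑ j, (e j : ℤ) * (d j : ℤ))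
  have hφ : ∀ e : Fin M →₀ ℕ, φ (MvPolynomial.monomial e 1) =
      t (n - ∑ j, (e j : ℤ) * (b j : ℤ)) (m - ∑ j, (e j : ℤ) * (d j : ℤ)) := by
    intro e
    have := (MvPolynomial.basisMonomials (Fin M) ℤ).constr_basis ℤ (fun e =>
      t (n - ∑ j, (e j : ℤ) * (b j : ℤ)) (m - ∑ j, (e j : ℤ) * (d j : ℤ))) e
    rwa [MvPolynomial.coe_basisMonomials] at this
  let P : MvPolynomial (Fin M) ℤ := ∑ j, MvPolynomial.X j
  have hpow : ∀ k, P ^ k = ∑ i ∈ Finset.Nat.antidiagonalTuple M k,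
      (Nat.multinomial Finset.univ i : ℤ) •
        MvPolynomial.monomial (Finsupp.equivFunOnFinite.symm i) (1 : ℤ) := by
    intro k
    rw [Finset.sum_pow_eq_sum_piAntidiag, Finset.piAntidiag_univ_fin_eq_antidiagonalTuple]
    refine Finset.sum_congr rfl fun i _ => ?_
    rw [← MvPolynomial.prod_X_pow_eq_monomial, zsmul_eq_mul]
    congr 1
    symm
    apply Finset.prod_subset (Finset.subset_univ _)
    intro j _ hj
    rw [Finsupp.notMem_support_iff] at hj
    rw [hj, pow_zero]
  have hmul : ∀ e : Fin M →₀ ℕ, φ (MvPolynomial.monomial e 1 * (1 + P)) =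
      S (n - ∑ j, (e j : ℤ) * (b j : ℤ)) (m - ∑ j, (e j : ℤ) * (d j : ℤ)) := by
    intro e
    have hr : ∑ j, (e j : ℤ) * (d j : ℤ) ≤ ∑ j, (e j : ℤ) * (b j : ℤ) :=
      Finset.sum_le_sum fun j _ =>
        mul_le_mul_of_nonneg_left (by exact_mod_cast hd j) (by positivity)
    rw [h _ _ (by omega), mul_add, mul_one, map_add, hφ, Finset.mul_sum, map_sum]
    congr 1
    refine Finset.sum_congr rfl fun j _ => ?_
    rw [MvPolynomial.X, MvPolynomial.monomial_mul, mul_one, hφ]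
    have hsum : ∀ f : Fin M → ℕ, ∑ l, ((e + Finsupp.single j 1 : Fin M →₀ ℕ) l : ℤ) * (f l : ℤ) =
        ∑ l, (e l : ℤ) * (f l : ℤ) + f j := by
      intro f
      simp [add_mul, Finset.sum_add_distrib, Finsupp.single_apply]
    rw [hsum, hsum, sub_add_eq_sub_sub, sub_add_eq_sub_sub]
  have hterm : ∀ k, (-1 : ℤ) ^ k * ∑ i ∈ Finset.Nat.antidiagonalTuple M k,
      (Nat.multinomial Finset.univ i : ℤ) *
        S (n - ∑ j, (i j : ℤ) * (b j : ℤ)) (m - ∑ j, (i j : ℤ) * (d j : ℤ)) =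
      φ ((-P) ^ k * (1 + P)) := by
    intro k
    have : (-P) ^ k * (1 + P) = (-1 : ℤ) ^ k • (P ^ k * (1 + P)) := by
      rw [neg_pow, zsmul_eq_mul]; push_cast; ring
    rw [this, map_smul, hpow, Finset.sum_mul, map_sum, smul_eq_mul]
    congr 1
    refine Finset.sum_congr rfl fun i _ => ?_
    rw [smul_mul_assoc, map_smul, hmul, smul_eq_mul]
    rfl
  have hzero : φ (P ^ (n.toNat + 1)) = 0 := by
    rw [hpow, map_sum]
    refine Finset.sum_eq_zero fun i hi => ?_
    rw [map_smul, hφ, ht, smul_zero]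
    have := hle _ i hi
    simp only [Finsupp.equivFunOnFinite_symm_apply_apply]
    omega
  have hgeom := geom_sum_mul (-P) (n.toNat + 1)
  have htele : ∑ k ∈ Finset.range (n.toNat + 1), (-P) ^ k * (1 + P) =
      1 - (-1 : ℤ) ^ (n.toNat + 1) • P ^ (n.toNat + 1) := by
    rw [← Finset.sum_mul, zsmul_eq_mul]
    push_cast
    rw [← neg_pow]
    linear_combination -hgeom
  rw [Finset.sum_congr rfl fun k _ => hterm k, ← map_sum, htele, map_sub, map_smul, hzero]
  simpa using hφ 0

/-- `w` ends with `p`, and this is the only occurrence of `p` in `w`. -/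
def EndsFirst (p w : Word) : Prop := p <:+ w ∧ Avoids p w.dropLast

/-- The number of ballot paths to `(n, m)` whose only occurrence of `p` is at the end. -/
noncomputable def endCount (p : Word) (n m : ℤ) : ℕ :=
  Set.ncard {w : Word | IsBallot w n m ∧ EndsFirst p w}

theorem countR_append (v w : Word) : countR (v ++ w) = countR v + countR w :=
  List.count_append

theorem countU_append (v w : Word) : countU (v ++ w) = countU v + countU w :=
  List.count_append

theorem countR_add_countU (w : Word) : countR w + countU w = w.length := by
  induction w with
  | nil => rfl
  | cons x w ih =>
    simp only [countR, countU] at ih ⊢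
    cases x <;> simp <;> omega

theorem setOf_isBallot_finite (n m : ℤ) : {w : Word | IsBallot w n m}.Finite := by
  have : Finite Step := Finite.of_surjective (fun x : Bool => if x then Step.u else Step.r)
    (by rintro (_ | _); exacts [⟨true, rfl⟩, ⟨false, rfl⟩])
  refine (List.finite_length_eq Step (n + m).toNat).subset ?_
  rintro w ⟨h1, h2, -⟩
  have := countR_add_countU w
  simp only [Set.mem_ofPred_eq]
  omega

theorem setOf_isBallot_and_finite (n m : ℤ) (Q : Word → Prop) :
    {w : Word | IsBallot w n m ∧ Q w}.Finite :=
  (setOf_isBallot_finite n m).subset fun _ h => h.1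

theorem s_eq_zero_of_neg (p : Word) {n : ℤ} (m : ℤ) (hn : n < 0) : s p n m = 0 := by
  rw [s, Set.ncard_eq_zero (setOf_isBallot_and_finite n m _), Set.eq_empty_iff_forall_notMem]
  rintro w ⟨⟨h, -⟩, -⟩
  omega

theorem endCount_eq_zero_of_neg (p : Word) {n : ℤ} (m : ℤ) (hn : n < 0) :
    endCount p n m = 0 := by
  rw [endCount, Set.ncard_eq_zero (setOf_isBallot_and_finite n m _),
    Set.eq_empty_iff_forall_notMem]
  rintro w ⟨⟨h, -⟩, -⟩
  omega

theorem DepthZero.suffix {p q : Word} (hp : DepthZero p) (h : q <:+ p) : DepthZero q :=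
  fun _ hx => hp _ (hx.trans h)

theorem DepthZero.countU_le {p : Word} (hp : DepthZero p) : countU p ≤ countR p := by
  have := hp p List.suffix_rfl
  rw [dval] at this
  omega

theorem prefix_append_cases {α : Type*} {x v q : List α} (h : x <+: v ++ q) :
    x <+: v ∨ ∃ z y, q = z ++ y ∧ x = v ++ z := by
  obtain ⟨y, hy⟩ := h
  rcases List.append_eq_append_iff.1 hy with ⟨z, h1, -⟩ | ⟨z, h1, h2⟩
  · exact Or.inl ⟨z, h1.symm⟩
  · exact Or.inr ⟨z, y, h2, h1⟩

/-- Appending a depth-zero word that ends weakly above the diagonal preserves ballot paths. -/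
theorem isBallot_append_iff {v q : Word} {n m : ℤ} (hq : DepthZero q) (hnm : n ≤ m) :
    IsBallot (v ++ q) n m ↔ IsBallot v (n - countR q) (m - countU q) := by
  constructor
  · rintro ⟨h1, h2, h3⟩
    rw [countR_append] at h1
    rw [countU_append] at h2
    exact ⟨by push_cast at h1; omega, by push_cast at h2; omega,
      fun x hx => h3 x (hx.trans (List.prefix_append _ _))⟩
  · rintro ⟨h1, h2, h3⟩
    refine ⟨by rw [countR_append]; push_cast; omega, by rw [countU_append]; push_cast; omega, ?_⟩
    intro x hx
    rcases prefix_append_cases hx with hx | ⟨z, y, rfl, rfl⟩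
    · exact h3 x hx
    · have hy := (hq.suffix (List.suffix_append z y)).countU_le
      simp only [countR_append, countU_append] at *
      push_cast at h1 h2
      omega

theorem isBallot_append_u_iff {v : Word} {n m : ℤ} :
    IsBallot (v ++ [Step.u]) n m ↔ IsBallot v n (m - 1) := by
  have hR : countR [Step.u] = 0 := rfl
  have hU : countU [Step.u] = 1 := rfl
  constructor
  · rintro ⟨h1, h2, h3⟩
    rw [countR_append, hR] at h1
    rw [countU_append, hU] at h2
    exact ⟨by omega, by omega, fun x hx => h3 x (hx.trans (List.prefix_append _ _))⟩
  · rintro ⟨h1, h2, h3⟩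
    refine ⟨by rw [countR_append]; omega, by rw [countU_append]; omega, ?_⟩
    intro x hx
    rcases List.prefix_concat_iff.1 hx with rfl | hx
    · have := h3 v List.prefix_rfl
      rw [countR_append, countU_append]; omega
    · exact h3 x hx

theorem isBallot_append_r_iff {v : Word} {n m : ℤ} (hnm : n ≤ m) :
    IsBallot (v ++ [Step.r]) n m ↔ IsBallot v (n - 1) m := by
  have h : DepthZero [Step.r] := by
    intro q hq
    rcases List.suffix_cons_iff.1 hq with rfl | hq
    · decide
    · rw [List.suffix_nil.1 hq]; decide
  have hR : countR [Step.r] = 1 := rfl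
  have hU : countU [Step.r] = 0 := rfl
  simpa [hR, hU] using isBallot_append_iff (v := v) h hnm

theorem avoids_or_endsFirst_iff {p v : Word} {x : Step} :
    Avoids p (v ++ [x]) ∨ EndsFirst p (v ++ [x]) ↔ Avoids p v := by
  simp only [Avoids, EndsFirst, List.dropLast_concat, List.infix_concat_iff]
  tauto

theorem s_add_endCount (p : Word) (n m : ℤ) (hn : 1 ≤ n) (hm : n ≤ m) :
    s p n m + endCount p n m = s p (n - 1) m + s p n (m - 1) := by
  have hinj : ∀ x : Step, Function.Injective fun v : Word => v ++ [x] :=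
    fun x => List.append_left_injective [x]
  rw [s, s, s, endCount, ← Set.ncard_union_eq _ (setOf_isBallot_and_finite ..)
    (setOf_isBallot_and_finite ..),
    ← Set.ncard_image_of_injective {w | IsBallot w (n - 1) m ∧ Avoids p w} (hinj Step.r),
    ← Set.ncard_image_of_injective {w | IsBallot w n (m - 1) ∧ Avoids p w} (hinj Step.u),
    ← Set.ncard_union_eq _ ((setOf_isBallot_and_finite ..).image _)
    ((setOf_isBallot_and_finite ..).image _)]
  · congr 1
    ext w
    rcases List.eq_nil_or_concat w with rfl | ⟨v, x, rfl⟩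
    · have : ¬ IsBallot [] n m := by
        rintro ⟨h, -⟩
        simp [countR] at h
        omega
      simp [this]
    · rw [Set.mem_union, Set.mem_ofPred_eq, Set.mem_ofPred_eq, ← and_or_left,
        List.concat_eq_append, avoids_or_endsFirst_iff]
      cases x
      · simp [isBallot_append_u_iff]
      · simp [isBallot_append_r_iff hm]
  · rw [Set.disjoint_left]
    rintro _ ⟨v, -, rfl⟩ ⟨w, -, h⟩
    simp at h
  · rw [Set.disjoint_left]
    rintro w ⟨-, h⟩ ⟨-, h', -⟩
    exact h h'.isInfix

theorem EndsFirst.append_ne {p w y : Word} (h : EndsFirst p w) (hy : p <:+ y)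
    {z : Word} (hz : z ≠ []) : y ++ z ≠ w := by
  rintro rfl
  refine h.2 (hy.isInfix.trans ?_)
  rw [List.dropLast_append_of_ne_nil hz]
  exact (List.prefix_append _ _).isInfix

theorem exists_endsFirst_append {p w : Word} (hp : p ≠ []) (h : p <:+: w) :
    ∃ y z, w = y ++ z ∧ EndsFirst p y := by
  induction w using List.reverseRecOn with
  | nil => exact absurd (List.infix_nil.1 h) hp
  | append_singleton w x ih =>
    by_cases h' : p <:+: w
    · obtain ⟨y, z, rfl, hy⟩ := ih h'
      exact ⟨y, z ++ [x], by simp, hy⟩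
    · exact ⟨w ++ [x], [], by simp, (List.infix_concat_iff.1 h).resolve_right h', by simpa [Avoids]⟩

theorem Avoids.of_append_suffix {p v x : Word} (hx : x ≠ []) (h : EndsFirst p (v ++ x)) :
    Avoids p v := fun hv => h.2 (by
  rw [List.dropLast_append_of_ne_nil hx]
  exact hv.trans (List.prefix_append _ _).isInfix)

theorem s_eq_endCount_add_sum {p : Word} {M : ℕ} {o p' : Fin M → Word}
    (hdz : DepthZero p) (hp : p ≠ [])
    (ho : ∀ j, IsBifix (o j) p) (hoinj : Function.Injective o)
    (hall : ∀ w : Word, IsBifix w p → ∃ j, w = o j)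
    (hsplit : ∀ j, o j ++ p' j = p) (n m : ℤ) (hm : n ≤ m) :
    s p (n - countR p) (m - countU p) =
      endCount p n m + ∑ j, endCount p (n - countR (p' j)) (m - countU (p' j)) := by
  have hinj : ∀ x : Word, Function.Injective fun v : Word => v ++ x :=
    fun x => List.append_left_injective x
  have hne : ∀ j, p' j ≠ [] := by
    intro j hj
    have := hsplit j
    rw [hj, List.append_nil] at this
    exact (ho j).2.1 this
  have hdz' : ∀ j, DepthZero (p' j) := fun j => hdz.suffix ⟨o j, hsplit j⟩
  have key : (fun v : Word => v ++ p) ''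
        {w | IsBallot w (n - countR p) (m - countU p) ∧ Avoids p w} =
      {w | IsBallot w n m ∧ EndsFirst p w} ∪ ⋃ j, (fun v : Word => v ++ p' j) ''
        {w | IsBallot w (n - countR (p' j)) (m - countU (p' j)) ∧ EndsFirst p w} := by
    ext w
    simp only [Set.mem_image, Set.mem_union, Set.mem_iUnion, Set.mem_ofPred_eq]
    constructor
    · rintro ⟨v, ⟨hv, hav⟩, rfl⟩
      rw [← isBallot_append_iff hdz hm] at hv
      obtain ⟨y, z, hyz, hy⟩ := exists_endsFirst_append hp (List.suffix_append v p).isInfix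
      rcases eq_or_ne z [] with rfl | hz
      · rw [List.append_nil] at hyz
        exact Or.inl ⟨hv, hyz ▸ hy⟩
      · right
        have hyp : y <+: v ++ p := ⟨z, hyz.symm⟩
        rcases prefix_append_cases hyp with hyv | ⟨x, x', hx, rfl⟩
        · exact absurd (hy.1.isInfix.trans hyv.isInfix) hav
        · rw [hx, List.append_assoc, List.append_cancel_left_eq,
            List.append_cancel_left_eq] at hyz
          subst hyz
          have hbif : IsBifix x p := by
            refine ⟨?_, ?_, ⟨x', hx.symm⟩, ?_⟩
            · rintro rfl
              rw [List.append_nil] at hy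
              exact hav hy.1.isInfix
            · intro h
              rw [h] at hx
              exact hz (List.self_eq_append_right.1 hx)
            · refine List.suffix_of_suffix_length_le (List.suffix_append v x) hy.1 ?_
              rw [hx]; simp
          obtain ⟨j, rfl⟩ := hall x hbif
          have hx' : p' j = x' := List.append_cancel_left ((hsplit j).trans hx)
          refine ⟨j, v ++ o j, ⟨?_, hy⟩, ?_⟩
          · rw [← isBallot_append_iff (hdz' j) hm, List.append_assoc, hsplit]
            exact hv
          · rw [List.append_assoc, hsplit]
    · rintro (⟨hw, h⟩ | ⟨j, y, ⟨hy, h⟩, rfl⟩)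
      · obtain ⟨v, rfl⟩ := h.1
        exact ⟨v, ⟨(isBallot_append_iff hdz hm).1 hw, .of_append_suffix hp h⟩, rfl⟩
      · obtain ⟨v, rfl⟩ := (ho j).2.2.2.trans h.1
        rw [← isBallot_append_iff (hdz' j) hm, List.append_assoc, hsplit] at hy
        exact ⟨v, ⟨(isBallot_append_iff hdz hm).1 hy, .of_append_suffix (ho j).1 h⟩,
          by rw [List.append_assoc, hsplit]⟩
  have hfin : ∀ j, ((fun v : Word => v ++ p' j) ''
      {w | IsBallot w (n - countR (p' j)) (m - countU (p' j)) ∧ EndsFirst p w}).Finite :=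
    fun j => (setOf_isBallot_and_finite ..).image _
  rw [s, ← Set.ncard_image_of_injective _ (hinj p), key, Set.ncard_union_eq _
    (setOf_isBallot_and_finite ..) (Set.finite_iUnion hfin), Set.ncard_iUnion_of_finite hfin,
    finsum_eq_sum_of_fintype]
  · simp only [Set.ncard_image_of_injective _ (hinj _), endCount]
  · intro i j hij
    rw [Function.onFun, Set.disjoint_left]
    rintro _ ⟨y, ⟨-, hy⟩, rfl⟩ ⟨y', ⟨-, hy'⟩, h⟩
    have hyy : y = y' ∧ p' i = p' j := by
      rcases List.append_eq_append_iff.1 h with ⟨z, h1, h2⟩ | ⟨z, h1, h2⟩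
      · rcases eq_or_ne z [] with rfl | hz
        · simp_all
        · exact absurd h1.symm (hy.append_ne hy'.1 hz)
      · rcases eq_or_ne z [] with rfl | hz
        · simp_all
        · exact absurd h1.symm (hy'.append_ne hy.1 hz)
    apply hij
    apply hoinj
    have := (hsplit i).trans (hsplit j).symm
    rw [hyy.2] at this
    exact List.append_cancel_right this
  · rw [Set.disjoint_iUnion_right]
    intro j
    rw [Set.disjoint_left]
    rintro _ ⟨-, h⟩ ⟨y, ⟨-, hy⟩, rfl⟩
    exact h.append_ne hy.1 (hne j) rfl

/-- Recurrence for ballot paths avoiding a depth-zero pattern `p` of dimensions `a × c`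
whose distinct bifixes are exactly `o 0, …, o (M-1)` (`M ≥ 1`), where `p = p'' j ++ o j`
and `p'' j` has dimensions `b j × d j` (each `b j ≥ 1`): for `n ≥ 1` and `m ≥ n`,
`s p n m = s p (n-1) m + s p n (m-1)
  - ∑_{k ≥ 0} (-1)^k ∑_{i₁+⋯+i_M = k} k!/(i₁!⋯i_M!) ⬝ s p (n-a-∑ i_j b_j) (m-c-∑ i_j d_j)`
(the outer sum is finite since `s p` vanishes on negative first argument). -/
theorem recurrence_many_bifixes (p : Word) (a c : ℕ) (M : ℕ) (hM : 1 ≤ M)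
    (o : Fin M → Word) (p'' : Fin M → Word) (b d : Fin M → ℕ)
    (hdz : DepthZero p)
    (ho : ∀ j, IsBifix (o j) p) (hoinj : Function.Injective o)
    (hall : ∀ w : Word, IsBifix w p → ∃ j, w = o j)
    (hsplit : ∀ j, p = p'' j ++ o j)
    (hdimR : countR p = a) (hdimU : countU p = c)
    (hdimR'' : ∀ j, countR (p'' j) = b j) (hdimU'' : ∀ j, countU (p'' j) = d j)
    (hb : ∀ j, 1 ≤ b j)
    (n m : ℤ) (hn : 1 ≤ n) (hm : n ≤ m) :
    (s p n m : ℤ) = (s p (n - 1) m : ℤ) + (s p n (m - 1) : ℤ) -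
      ∑ᶠ k : ℕ, (-1 : ℤ) ^ k *
        ∑ i ∈ Finset.Nat.antidiagonalTuple M k,
          (Nat.multinomial Finset.univ i : ℤ) *
            (s p (n - a - ∑ j, (i j : ℤ) * (b j : ℤ))
               (m - c - ∑ j, (i j : ℤ) * (d j : ℤ)) : ℤ) := by
  choose p' hp' using fun j => (ho j).2.2.1
  have hR : ∀ j, countR (p' j) = b j := by
    intro j
    have h1 := congrArg countR (hp' j)
    have h2 := congrArg countR (hsplit j)
    rw [countR_append] at h1 h2
    have := hdimR'' j
    omega
  have hU : ∀ j, countU (p' j) = d j := by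
    intro j
    have h1 := congrArg countU (hp' j)
    have h2 := congrArg countU (hsplit j)
    rw [countU_append] at h1 h2
    have := hdimU'' j
    omega
  have hp : p ≠ [] := by
    rintro rfl
    exact (ho ⟨0, hM⟩).1 (List.prefix_nil.1 (ho ⟨0, hM⟩).2.2.1)
  have hd : ∀ j, d j ≤ b j := by
    intro j
    rw [← hR j, ← hU j]
    exact (hdz.suffix ⟨o j, hp' j⟩).countU_le
  have hinv := finsum_multinomial_shift_eq b d (fun n m => (endCount p n m : ℤ))
    (fun n m => (s p (n - a) (m - c) : ℤ)) hb hd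
    (fun n m h => by simp only [endCount_eq_zero_of_neg p m h, Nat.cast_zero])
    (fun n m h => by
      simp only [s_eq_zero_of_neg p (m - c) (show n - a < 0 by omega), Nat.cast_zero])
    (fun n m h => by
      have := s_eq_endCount_add_sum hdz hp ho hoinj hall hp' n m h
      simp only [hdimR, hdimU, hR, hU] at this
      exact_mod_cast this) n m hm
  simp only [sub_right_comm _ _ (a : ℤ), sub_right_comm _ _ (c : ℤ)] at hinv
  rw [hinv]
  have := s_add_endCount p n m hn hm
  omega
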